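/- Let X be a nonempty compact path-connected metric space and x₀ ∈ X a basepoint. Assume: (a) for all x, y ∈ X there exists a path from x to y whose length (the total variation of the path over the unit interval) equals dist x y; and (b) there exists δ > 0 such that every loop whose image is contained in some open ball of radius δ is homotopic rel endpoints to a constant loop. Then for every ε > 0, the fundamental group π₁(X, x₀) is generated by the set of homotopy classes of loops based at x₀ whose length is at most 2 · diam X + ε. -/

import Mathlib

attribute [local instance] Path.Homotopic.setoid

open CategoryTheory Topology

/-- A property of homotopy classes of paths that is stable under composition and inversion and
holds for all paths near their starting point holds for every path. -/
theorem Path.Homotopic.Quotient.induction_of_local {X : Type*} [TopologicalSpace X]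
    {P : ∀ {x y : X}, Path.Homotopic.Quotient x y → Prop}
    (htrans : ∀ {x y z : X} (p : Path.Homotopic.Quotient x y) (q : Path.Homotopic.Quotient y z),
      P p → P q → P (p.trans q))
    (hsymm : ∀ {x y : X} (p : Path.Homotopic.Quotient x y), P p → P p.symm)
    (hlocal : ∀ x : X, ∃ U ∈ 𝓝 x, ∀ (y : X) (p : Path x y), Set.range p ⊆ U → P (mk p))
    {x y : X} (p : Path.Homotopic.Quotient x y) : P p := by
  induction p using Path.Homotopic.Quotient.ind with | _ γ
  have hsub (r s t : unitInterval) :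
      (mk (γ.subpath r s)).trans (mk (γ.subpath s t)) = mk (γ.subpath r t) :=
    Path.Homotopic.Quotient.eq.2 ⟨Path.Homotopy.subpathTransSubpath γ r s t⟩
  have hconst : IsLocallyConstant fun t : unitInterval ↦ P (mk (γ.subpath 0 t)) := by
    refine (IsLocallyConstant.iff_eventually_eq _).2 fun s ↦ ?_
    obtain ⟨U, hU, hPU⟩ := hlocal (γ s)
    obtain ⟨η, hη, hball⟩ := Metric.mem_nhds_iff.1 (γ.continuous.continuousAt hU)
    filter_upwards [Metric.ball_mem_nhds s hη] with t ht
    have hst : P (mk (γ.subpath s t)) := by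
      refine hPU _ _ ?_
      rw [Path.range_subpath]
      rintro _ ⟨u, hu, rfl⟩
      refine hball (Metric.mem_ball.2 (lt_of_le_of_lt ?_ (Metric.mem_ball.1 ht)))
      rw [dist_comm u, dist_comm t]
      exact Real.dist_left_le_of_mem_uIcc (y := (u : ℝ)) (z := t) hu
    refine propext ⟨fun h ↦ ?_, fun h ↦ ?_⟩
    · have hts := hsymm _ hst
      rw [← Path.Homotopic.Quotient.mk_symm, Path.symm_subpath] at hts
      exact hsub 0 t s ▸ htrans _ _ h hts
    · exact hsub 0 s t ▸ htrans _ _ h hst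
  have hzero : P (mk (γ.subpath 0 0)) := by
    obtain ⟨U, hU, hPU⟩ := hlocal (γ 0)
    refine hPU _ _ ?_
    simpa using mem_of_mem_nhds hU
  have hone : P (mk (γ.subpath 0 1)) :=
    (hconst.apply_eq_of_preconnectedSpace 0 1).mp hzero
  rw [Path.subpath_zero_one] at hone
  have hcast {a b : X} (ha : a = x) (hb : b = y) (h : P (mk (γ.cast ha hb))) : P (mk γ) := by
    subst ha hb
    simpa using h
  exact hcast _ _ hone

theorem Path.eVariationOn_symm_le {X : Type*} [PseudoEMetricSpace X] {x y : X} (γ : Path x y) :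
    eVariationOn γ.symm Set.univ ≤ eVariationOn γ Set.univ :=
  eVariationOn.comp_le_of_antitoneOn γ unitInterval.symm
    (fun _ _ _ _ h ↦ sub_le_sub_left (α := ℝ) h 1) (Set.mapsTo_univ _ _)

theorem Path.eVariationOn_trans_le {X : Type*} [PseudoEMetricSpace X] {x y z : X}
    (γ : Path x y) (γ' : Path y z) :
    eVariationOn (γ.trans γ') Set.univ ≤ eVariationOn γ Set.univ + eVariationOn γ' Set.univ := by
  let h : unitInterval := ⟨1 / 2, by norm_num, by norm_num⟩
  have huniv : eVariationOn (γ.trans γ') Set.univ =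
      eVariationOn (γ.trans γ') (Set.Iic h ∪ Set.Ici h) := by
    rw [Set.Iic_union_Ici]
  rw [huniv, eVariationOn.union _ isGreatest_Iic isLeast_Ici]
  refine add_le_add ?_ ?_
  · let φ : unitInterval → unitInterval := fun t ↦ Set.projIcc 0 1 zero_le_one (2 * t)
    have hφ : Set.EqOn (γ.trans γ') (γ ∘ φ) (Set.Iic h) := fun t ht ↦
      ((γ.trans γ').extend_apply t.2).symm.trans (γ.extend_trans_of_le_half γ' ht)
    rw [eVariationOn.eq_of_eqOn hφ]
    refine eVariationOn.comp_le_of_monotoneOn _ φ (fun s _ t _ hst ↦ ?_) (Set.mapsTo_univ _ _)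
    exact Set.monotone_projIcc _ (mul_le_mul_of_nonneg_left (α := ℝ) hst zero_le_two)
  · let φ : unitInterval → unitInterval := fun t ↦ Set.projIcc 0 1 zero_le_one (2 * t - 1)
    have hφ : Set.EqOn (γ.trans γ') (γ' ∘ φ) (Set.Ici h) := fun t ht ↦
      ((γ.trans γ').extend_apply t.2).symm.trans (γ.extend_trans_of_half_le γ' ht)
    rw [eVariationOn.eq_of_eqOn hφ]
    refine eVariationOn.comp_le_of_monotoneOn _ φ (fun s _ t _ hst ↦ ?_) (Set.mapsTo_univ _ _)
    exact Set.monotone_projIcc _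
      (sub_le_sub_right (mul_le_mul_of_nonneg_left (α := ℝ) hst zero_le_two) 1)

theorem Path.range_subset_ball_of_eVariationOn_lt {X : Type*} [PseudoMetricSpace X] {x y : X}
    (γ : Path x y) {r : ℝ} (hγ : eVariationOn γ Set.univ < ENNReal.ofReal r) :
    Set.range γ ⊆ Metric.ball x r := by
  rintro _ ⟨t, rfl⟩
  have ht := (eVariationOn.edist_le γ (Set.mem_univ t) (Set.mem_univ 0)).trans_lt hγ
  rw [γ.source, edist_dist] at ht
  exact (ENNReal.ofReal_lt_ofReal_iff'.1 ht).1

/-- Two paths with the same endpoints lying in a set whose loops are null-homotopic are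
homotopic. -/
theorem Path.Homotopic.of_range_subset {X : Type*} [TopologicalSpace X] {U : Set X}
    (hU : ∀ (x : X) (γ : Path x x), Set.range γ ⊆ U → γ.Homotopic (Path.refl x))
    {x y : X} {p q : Path x y} (hp : Set.range p ⊆ U) (hq : Set.range q ⊆ U) :
    p.Homotopic q := by
  have hpq : (p.trans q.symm).Homotopic (Path.refl x) := by
    refine hU x _ ?_
    rw [Path.trans_range, Path.symm_range]
    exact Set.union_subset hp hq
  have hinv : FundamentalGroupoid.fromPath (.mk p) ≫
      CategoryTheory.inv (FundamentalGroupoid.fromPath (.mk q)) = 𝟙 _ := by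
    rw [← Groupoid.inv_eq_inv]
    exact Path.Homotopic.Quotient.eq.2 hpq
  rw [← FundamentalGroupoid.fromPath_eq_iff_homotopic]
  exact by simpa using (IsIso.comp_inv_eq _).1 hinv

/-- In a nonempty compact path-connected metric space in which every pair of points is joined by
a path of length `dist x y`, and which is uniformly semilocally simply connected, the fundamental
group at any basepoint is generated by the classes of loops of length at most `2 · diam X + ε`. -/
theorem fundamentalGroup_generated_by_loops_of_length_le_two_diam
    (X : Type*) [MetricSpace X] [Nonempty X] [CompactSpace X] [PathConnectedSpace X]
    (x₀ : X)
    (hgeo : ∀ x y : X, ∃ γ : Path x y,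
        eVariationOn (γ : unitInterval → X) Set.univ = ENNReal.ofReal (dist x y))
    (hslsc : ∃ δ > (0 : ℝ), ∀ (x : X) (γ : Path x x),
        (∃ c : X, Set.range γ ⊆ Metric.ball c δ) → Path.Homotopic γ (Path.refl x))
    (ε : ℝ) (hε : 0 < ε) :
    Subgroup.closure
      { g : FundamentalGroup X x₀ |
        ∃ γ : Path x₀ x₀,
          eVariationOn (γ : unitInterval → X) Set.univ ≤
            ENNReal.ofReal (2 * Metric.diam (Set.univ : Set X) + ε) ∧
          FundamentalGroup.fromPath (X := TopCat.of X) ⟦γ⟧ = g } = ⊤ := by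
  obtain ⟨δ, hδ, hδ'⟩ := hslsc
  choose g hg using hgeo
  set S : Set (FundamentalGroup X x₀) := { g | ∃ γ : Path x₀ x₀, _ }
  have hdist (x y : X) : dist x y ≤ Metric.diam (Set.univ : Set X) :=
    Metric.dist_le_diam_of_mem (Metric.isBounded_of_compactSpace) (Set.mem_univ x) (Set.mem_univ y)
  let c (x : X) : FundamentalGroupoid.mk x₀ ⟶ FundamentalGroupoid.mk x :=
    FundamentalGroupoid.fromPath (.mk (g x₀ x))
  let φ {x y : X} (f : FundamentalGroupoid.mk x ⟶ FundamentalGroupoid.mk y) :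
    FundamentalGroup X x₀ := c x ≫ f ≫ Groupoid.inv (c y)
  have hφ {x y : X} (p : Path.Homotopic.Quotient x y) :
      φ (FundamentalGroupoid.fromPath p) ∈ Subgroup.closure S := by
    refine Path.Homotopic.Quotient.induction_of_local
      (P := fun p ↦ φ (FundamentalGroupoid.fromPath p) ∈ Subgroup.closure S) ?_ ?_ ?_ p
    · intro x y z p q hp hq
      have h : φ (FundamentalGroupoid.fromPath (p.trans q)) =
          φ (FundamentalGroupoid.fromPath q) * φ (FundamentalGroupoid.fromPath p) := by
        change c x ≫ (FundamentalGroupoid.fromPath p ≫ FundamentalGroupoid.fromPath q) ≫ _ =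
          (c x ≫ FundamentalGroupoid.fromPath p ≫ _) ≫ c y ≫ FundamentalGroupoid.fromPath q ≫ _
        simp
      exact h ▸ mul_mem hq hp
    · intro x y p hp
      have h : φ (FundamentalGroupoid.fromPath p.symm) = (φ (FundamentalGroupoid.fromPath p))⁻¹ := by
        change c y ≫ Groupoid.inv (FundamentalGroupoid.fromPath p) ≫ _ =
          Groupoid.inv (c x ≫ FundamentalGroupoid.fromPath p ≫ Groupoid.inv (c y))
        simp
      exact h ▸ inv_mem hp
    · intro x
      refine ⟨Metric.ball x (min δ ε), Metric.ball_mem_nhds x (lt_min hδ hε), fun y p hp ↦ ?_⟩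
      have hxy : dist x y < min δ ε := by
        simpa [dist_comm] using hp ⟨1, p.target⟩
      have hpg : p.Homotopic (g x y) := by
        refine .of_range_subset (fun z γ hγ ↦ hδ' z γ ⟨x, hγ⟩)
          (hp.trans (Metric.ball_subset_ball (min_le_left δ ε)))
          ((g x y).range_subset_ball_of_eVariationOn_lt ?_)
        rw [hg, ENNReal.ofReal_lt_ofReal_iff hδ]
        exact hxy.trans_le (min_le_left δ ε)
      refine Subgroup.subset_closure
        ⟨(g x₀ x).trans ((g x y).trans (g x₀ y).symm), ?_, ?_⟩
      · refine ((g x₀ x).eVariationOn_trans_le _).trans ((add_le_add_right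
          (((g x y).eVariationOn_trans_le _).trans
            (add_le_add_right (g x₀ y).eVariationOn_symm_le _)) _).trans ?_)
        rw [hg, hg, hg, ← ENNReal.ofReal_add dist_nonneg dist_nonneg,
          ← ENNReal.ofReal_add dist_nonneg (by positivity)]
        refine ENNReal.ofReal_le_ofReal ?_
        linarith [hdist x₀ x, hdist x₀ y, hxy.trans_le (min_le_right δ ε)]
      · rw [Path.Homotopic.Quotient.eq.2 hpg]
        rfl
  have hc : (c x₀ : FundamentalGroup X x₀) ∈ Subgroup.closure S := by
    refine Subgroup.subset_closure ⟨g x₀ x₀, ?_, rfl⟩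
    rw [hg]
    refine ENNReal.ofReal_le_ofReal ?_
    linarith [hdist x₀ x₀, dist_self x₀]
  refine (Subgroup.eq_top_iff' _).2 fun p ↦ ?_
  let c₀ : FundamentalGroup X x₀ := c x₀
  have hp : c₀⁻¹ * p * c₀ ∈ Subgroup.closure S := by
    have h : φ p = c₀⁻¹ * p * c₀ := rfl
    exact h ▸ hφ p
  have hconj : p = c₀ * (c₀⁻¹ * p * c₀) * c₀⁻¹ := by group
  rw [hconj]
  exact mul_mem (mul_mem hc hp) (inv_mem hc)
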